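/- arXiv:2602.16880 — 2 statements merged into one kernel-verified Lean document; each statement's English description precedes it below -/
import Mathlib

section
/- The logic CK has the Craig interpolation property: for all formulas φ and ψ, if ⊢_CK φ → ψ then there exists a formula θ with vars(θ) ⊆ vars(φ) ∩ vars(ψ) such that ⊢_CK φ → θ and ⊢_CK θ → ψ. -/
/-- Formulas of the modal language: φ ::= p | ⊥ | φ∧φ | φ∨φ | φ→φ | □φ | ◇φ. -/
inductive Form : Type
  | var : ℕ → Form
  | bot : Form
  | and : Form → Form → Form
  | or  : Form → Form → Form
  | imp : Form → Form → Form
  | box : Form → Form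
  | dia : Form → Form
  deriving DecidableEq

/-- Helper for □⁻¹: remove an outer box. -/
def unboxF : Form → Option Form
  | Form.box φ => some φ
  | _ => none

/-- □⁻¹Γ := {φ | □φ ∈ Γ}, as a multiset operation. -/
def boxInv (Γ : Multiset Form) : Multiset Form := Γ.filterMap unboxF

/-- ◇⁻¹Δ for a succedent Δ with at most one formula (modelled by `Option`). -/
def diaInv : Option Form → Option Form
  | some (Form.dia φ) => some φ
  | _ => none

/-- Provability in the sequent calculus G4CK: sequents Γ ⇒ δ with a
multiset antecedent and a single-formula succedent. -/
inductive G4CK : Multiset Form → Form → Prop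
  | botL (Γ δ) : G4CK (Form.bot ::ₘ Γ) δ
  | idP (Γ n) : G4CK (Form.var n ::ₘ Γ) (Form.var n)
  | andL (Γ φ ψ δ) : G4CK (φ ::ₘ ψ ::ₘ Γ) δ → G4CK (Form.and φ ψ ::ₘ Γ) δ
  | andR (Γ φ ψ) : G4CK Γ φ → G4CK Γ ψ → G4CK Γ (Form.and φ ψ)
  | orL (Γ φ ψ δ) : G4CK (φ ::ₘ Γ) δ → G4CK (ψ ::ₘ Γ) δ → G4CK (Form.or φ ψ ::ₘ Γ) δ
  | orR1 (Γ φ ψ) : G4CK Γ φ → G4CK Γ (Form.or φ ψ)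
  | orR2 (Γ φ ψ) : G4CK Γ ψ → G4CK Γ (Form.or φ ψ)
  | impR (Γ φ ψ) : G4CK (φ ::ₘ Γ) ψ → G4CK Γ (Form.imp φ ψ)
  | andImpL (Γ φ ψ χ δ) :
      G4CK (Form.imp φ (Form.imp ψ χ) ::ₘ Γ) δ →
      G4CK (Form.imp (Form.and φ ψ) χ ::ₘ Γ) δ
  | orImpL (Γ φ ψ χ δ) :
      G4CK (Form.imp φ χ ::ₘ Form.imp ψ χ ::ₘ Γ) δ →
      G4CK (Form.imp (Form.or φ ψ) χ ::ₘ Γ) δ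
  | pImpL (Γ n φ δ) :
      G4CK (Form.var n ::ₘ φ ::ₘ Γ) δ →
      G4CK (Form.var n ::ₘ Form.imp (Form.var n) φ ::ₘ Γ) δ
  | impImpL (Γ φ ψ χ δ) :
      G4CK (Form.imp ψ χ ::ₘ Γ) (Form.imp φ ψ) → G4CK (χ ::ₘ Γ) δ →
      G4CK (Form.imp (Form.imp φ ψ) χ ::ₘ Γ) δ
  | boxR (Γ φ) : G4CK (boxInv Γ) φ → G4CK Γ (Form.box φ)
  | boxImpL (Γ φ ψ δ) :
      G4CK (boxInv Γ) φ → G4CK (ψ ::ₘ Γ) δ →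
      G4CK (Form.imp (Form.box φ) ψ ::ₘ Γ) δ
  | diaImpL (Γ γ φ ψ δ) :
      G4CK (γ ::ₘ boxInv Γ) φ → G4CK (ψ ::ₘ Form.dia γ ::ₘ Γ) δ →
      G4CK (Form.imp (Form.dia φ) ψ ::ₘ Form.dia γ ::ₘ Γ) δ
  | diaL (Γ φ ψ) : G4CK (φ ::ₘ boxInv Γ) ψ → G4CK (Form.dia φ ::ₘ Γ) (Form.dia ψ)

/-- Provability in the sequent calculus G4WK: sequents Γ ⇒ Δ with a
multiset antecedent and a succedent with at most one formula (`Option Form`). -/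
inductive G4WK : Multiset Form → Option Form → Prop
  | botL (Γ Δ) : G4WK (Form.bot ::ₘ Γ) Δ
  | idP (Γ n) : G4WK (Form.var n ::ₘ Γ) (some (Form.var n))
  | andL (Γ φ ψ Δ) : G4WK (φ ::ₘ ψ ::ₘ Γ) Δ → G4WK (Form.and φ ψ ::ₘ Γ) Δ
  | andR (Γ φ ψ) : G4WK Γ (some φ) → G4WK Γ (some ψ) → G4WK Γ (some (Form.and φ ψ))
  | orL (Γ φ ψ Δ) : G4WK (φ ::ₘ Γ) Δ → G4WK (ψ ::ₘ Γ) Δ → G4WK (Form.or φ ψ ::ₘ Γ) Δ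
  | orR1 (Γ φ ψ) : G4WK Γ (some φ) → G4WK Γ (some (Form.or φ ψ))
  | orR2 (Γ φ ψ) : G4WK Γ (some ψ) → G4WK Γ (some (Form.or φ ψ))
  | impR (Γ φ ψ) : G4WK (φ ::ₘ Γ) (some ψ) → G4WK Γ (some (Form.imp φ ψ))
  | andImpL (Γ φ ψ χ Δ) :
      G4WK (Form.imp φ (Form.imp ψ χ) ::ₘ Γ) Δ →
      G4WK (Form.imp (Form.and φ ψ) χ ::ₘ Γ) Δ
  | orImpL (Γ φ ψ χ Δ) :
      G4WK (Form.imp φ χ ::ₘ Form.imp ψ χ ::ₘ Γ) Δ →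
      G4WK (Form.imp (Form.or φ ψ) χ ::ₘ Γ) Δ
  | pImpL (Γ n φ Δ) :
      G4WK (Form.var n ::ₘ φ ::ₘ Γ) Δ →
      G4WK (Form.var n ::ₘ Form.imp (Form.var n) φ ::ₘ Γ) Δ
  | impImpL (Γ φ ψ χ Δ) :
      G4WK (Form.imp ψ χ ::ₘ Γ) (some (Form.imp φ ψ)) → G4WK (χ ::ₘ Γ) Δ →
      G4WK (Form.imp (Form.imp φ ψ) χ ::ₘ Γ) Δ
  | boxR (Γ φ) : G4WK (boxInv Γ) (some φ) → G4WK Γ (some (Form.box φ))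
  | boxImpL (Γ φ ψ Δ) :
      G4WK (boxInv Γ) (some φ) → G4WK (ψ ::ₘ Γ) Δ →
      G4WK (Form.imp (Form.box φ) ψ ::ₘ Γ) Δ
  | diaImpL (Γ γ φ ψ Δ) :
      G4WK (γ ::ₘ boxInv Γ) (some φ) → G4WK (ψ ::ₘ Form.dia γ ::ₘ Γ) Δ →
      G4WK (Form.imp (Form.dia φ) ψ ::ₘ Form.dia γ ::ₘ Γ) Δ
  | diaL' (Γ φ Δ) : G4WK (φ ::ₘ boxInv Γ) (diaInv Δ) → G4WK (Form.dia φ ::ₘ Γ) Δ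

/-- Axiom schemes of the generalised Hilbert calculus CKH:
intuitionistic axioms A1–A9 together with K_□ and K_◇. -/
inductive CKAx : Form → Prop
  | a1 (φ ψ : Form) : CKAx (φ.imp (ψ.imp φ))
  | a2 (φ ψ χ : Form) : CKAx ((φ.imp (ψ.imp χ)).imp ((φ.imp ψ).imp (φ.imp χ)))
  | a3 (φ ψ : Form) : CKAx (φ.imp (φ.or ψ))
  | a4 (φ ψ : Form) : CKAx (ψ.imp (φ.or ψ))
  | a5 (φ ψ χ : Form) : CKAx ((φ.imp χ).imp ((ψ.imp χ).imp ((φ.or ψ).imp χ)))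
  | a6 (φ ψ : Form) : CKAx ((φ.and ψ).imp φ)
  | a7 (φ ψ : Form) : CKAx ((φ.and ψ).imp ψ)
  | a8 (φ ψ χ : Form) : CKAx ((φ.imp ψ).imp ((φ.imp χ).imp (φ.imp (ψ.and χ))))
  | a9 (φ : Form) : CKAx (Form.bot.imp φ)
  | kbox (φ ψ : Form) : CKAx ((φ.imp ψ).box.imp (φ.box.imp ψ.box))
  | kdia (φ ψ : Form) : CKAx ((φ.imp ψ).box.imp (φ.dia.imp ψ.dia))

/-- Axiom schemes of WKH: those of CKH together with N : ¬◇⊥. -/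
inductive WKAx : Form → Prop
  | ck {φ : Form} : CKAx φ → WKAx φ
  | n : WKAx (Form.bot.dia.imp Form.bot)

/-- Derivability Γ ⊢ φ in the generalised Hilbert calculus CKH. -/
inductive CKH : Set Form → Form → Prop
  | ax {Γ : Set Form} {φ : Form} : CKAx φ → CKH Γ φ
  | el {Γ : Set Form} {φ : Form} : φ ∈ Γ → CKH Γ φ
  | mp {Γ : Set Form} {φ ψ : Form} : CKH Γ φ → CKH Γ (φ.imp ψ) → CKH Γ ψ
  | nec {Γ : Set Form} {φ : Form} : CKH ∅ φ → CKH Γ φ.box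

/-- Derivability Γ ⊢ φ in the generalised Hilbert calculus WKH. -/
inductive WKH : Set Form → Form → Prop
  | ax {Γ : Set Form} {φ : Form} : WKAx φ → WKH Γ φ
  | el {Γ : Set Form} {φ : Form} : φ ∈ Γ → WKH Γ φ
  | mp {Γ : Set Form} {φ ψ : Form} : WKH Γ φ → WKH Γ (φ.imp ψ) → WKH Γ ψ
  | nec {Γ : Set Form} {φ : Form} : WKH ∅ φ → WKH Γ φ.box

/-- The set of propositional variables occurring in a formula. -/
def vars : Form → Set ℕ
  | .var n => {n}
  | .bot => ∅
  | .and φ ψ => vars φ ∪ vars ψ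
  | .or φ ψ => vars φ ∪ vars ψ
  | .imp φ ψ => vars φ ∪ vars ψ
  | .box φ => vars φ
  | .dia φ => vars φ

/-- Variables occurring in a multiset of formulas. -/
def varsM (Γ : Multiset Form) : Set ℕ := {n | ∃ φ ∈ Γ, n ∈ vars φ}

/-- Variables occurring in a succedent with at most one formula. -/
def varsO : Option Form → Set ℕ
  | none => ∅
  | some φ => vars φ

/-- Heyting algebras with the modal operations of the logic CK. -/
class CKAlgebra (H : Type*) extends HeytingAlgebra H where
  box : H → H
  dia : H → H
  box_top : box ⊤ = ⊤
  box_mono : Monotone box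
  box_inf_box_le : ∀ a b, box a ⊓ box b ≤ box (a ⊓ b)
  dia_mono : Monotone dia
  box_inf_dia_le : ∀ a b, box a ⊓ dia b ≤ dia (a ⊓ b)

/-- Subalgebras of a CK-algebra. -/
structure CKSubalgebra (H : Type*) [CKAlgebra H] where
  carrier : Set H
  bot_mem : ⊥ ∈ carrier
  inf_mem : ∀ {a b}, a ∈ carrier → b ∈ carrier → a ⊓ b ∈ carrier
  sup_mem : ∀ {a b}, a ∈ carrier → b ∈ carrier → a ⊔ b ∈ carrier
  himp_mem : ∀ {a b}, a ∈ carrier → b ∈ carrier → a ⇨ b ∈ carrier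
  box_mem : ∀ {a}, a ∈ carrier → CKAlgebra.box a ∈ carrier
  dia_mem : ∀ {a}, a ∈ carrier → CKAlgebra.dia a ∈ carrier

namespace CKSubalgebra

open CKAlgebra

variable {H : Type*} [CKAlgebra H] (C : CKSubalgebra H)

theorem top_mem : ⊤ ∈ C.carrier := by
  simpa using C.himp_mem C.bot_mem C.bot_mem

/-- The two-sided context `p` entails `d`, placed on side `s`, through an interpolant in `C`. -/
def Entails (p : Bool → H) (s : Bool) (d : H) : Prop :=
  ∃ c ∈ C.carrier, p (!s) ≤ c ∧ p s ⊓ c ≤ d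

/-- The context consisting of `d` on side `s`. -/
def single (s : Bool) (d : H) : Bool → H := Function.update ⊤ s d

@[simp] theorem single_self (s : Bool) (d : H) : single s d s = d := by simp [single]

@[simp] theorem single_not (s : Bool) (d : H) : single s d (!s) = ⊤ := by simp [single]

/-- The closure operator whose basic closed sets are `{q | C.Entails (q ⊓ r) s f}`. -/
def closure (X : Set (Bool → H)) : Set (Bool → H) :=
  {p | ∀ r s f, (∀ q ∈ X, C.Entails (q ⊓ r) s f) → C.Entails (p ⊓ r) s f}

/-- The contexts that entail `d` on side `s`. -/
def below (s : Bool) (d : H) : Set (Bool → H) := {p | C.Entails p s d}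

variable {C} {p q r u : Bool → H} {X Y Z : Set (Bool → H)} {s t : Bool} {d e f : H}

theorem Entails.anti (h : C.Entails q s d) (hpq : p ≤ q) : C.Entails p s d := by
  obtain ⟨c, hc, h1, h2⟩ := h
  exact ⟨c, hc, (hpq _).trans h1, (inf_le_inf_right _ (hpq _)).trans h2⟩

theorem Entails.cut (h : C.Entails p s d) (h' : C.Entails (single s d ⊓ r) t f) :
    C.Entails (p ⊓ r) t f := by
  obtain ⟨c, hc, h1, h2⟩ := h
  obtain ⟨c', hc', h3, h4⟩ := h'
  rcases Bool.eq_or_eq_not t s with rfl | rfl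
  · refine ⟨c ⊓ c', C.inf_mem hc hc', ?_, ?_⟩
    · simp only [Pi.inf_apply, single_not, top_inf_eq] at h3 ⊢
      exact inf_le_inf h1 h3
    · simp only [Pi.inf_apply, single_self] at h4 ⊢
      refine le_trans ?_ h4
      rw [inf_inf_inf_comm, inf_assoc d]
      exact inf_le_inf_right _ h2
  · refine ⟨c ⇨ c', C.himp_mem hc hc', ?_, ?_⟩
    · simp only [Pi.inf_apply, single_self, Bool.not_not] at h3 ⊢
      rw [le_himp_iff, inf_right_comm]
      exact (inf_le_inf_right _ h2).trans h3
    · simp only [Pi.inf_apply, single_not, top_inf_eq] at h4 ⊢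
      refine le_trans (le_inf (inf_le_left.trans inf_le_right) ?_) h4
      exact (inf_le_inf_right _ (inf_le_left.trans h1)).trans inf_himp_le

theorem entails_single_bot : C.Entails (single s ⊥ ⊓ r) t f := by
  rcases Bool.eq_or_eq_not t s with rfl | rfl
  · exact ⟨⊤, C.top_mem, le_top, by simp⟩
  · exact ⟨⊥, C.bot_mem, by simp, by simp⟩

theorem Entails.single_sup (h : C.Entails (single s d ⊓ r) t f)
    (h' : C.Entails (single s e ⊓ r) t f) : C.Entails (single s (d ⊔ e) ⊓ r) t f := by
  obtain ⟨c, hc, h1, h2⟩ := h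
  obtain ⟨c', hc', h3, h4⟩ := h'
  rcases Bool.eq_or_eq_not t s with rfl | rfl
  · simp only [Pi.inf_apply, single_not, single_self, top_inf_eq] at h1 h2 h3 h4
    refine ⟨c ⊓ c', C.inf_mem hc hc', by simp [h1, h3], ?_⟩
    simp only [Pi.inf_apply, single_self]
    rw [inf_assoc, inf_sup_right]
    refine sup_le (le_trans ?_ h2) (le_trans ?_ h4) <;> rw [inf_assoc] <;> gcongr
    exacts [inf_le_left, inf_le_right]
  · simp only [Pi.inf_apply, single_not, single_self, top_inf_eq, Bool.not_not] at h1 h2 h3 h4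
    refine ⟨c ⊔ c', C.sup_mem hc hc', ?_, ?_⟩
    · simp only [Pi.inf_apply, single_self, Bool.not_not, inf_sup_right]
      exact sup_le_sup h1 h3
    · simp only [Pi.inf_apply, single_not, top_inf_eq, inf_sup_left]
      exact sup_le h2 h4

theorem subset_closure : X ⊆ C.closure X := fun p hp _ _ _ h => h p hp

theorem inf_mem_of_mem_closure (hZ : C.closure Z ⊆ Z) (h : ∀ x ∈ X, x ⊓ u ∈ Z)
    (hq : q ∈ C.closure X) : q ⊓ u ∈ Z := by
  refine hZ fun r s f hr => ?_
  rw [inf_assoc]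
  exact hq _ _ _ fun x hx => by simpa [inf_assoc] using hr _ (h x hx)

theorem closure_subset (hZ : C.closure Z ⊆ Z) (h : X ⊆ Z) : C.closure X ⊆ Z := fun q hq => by
  simpa using inf_mem_of_mem_closure (u := ⊤) hZ (fun x hx => by simpa using h hx) hq

theorem closure_closure_subset : C.closure (C.closure X) ⊆ C.closure X :=
  fun _ hp _ _ _ h => hp _ _ _ fun _ hq => hq _ _ _ h

theorem mem_of_le (hZ : C.closure Z ⊆ Z) (hq : q ∈ Z) (h : p ≤ q) : p ∈ Z :=
  hZ fun _ _ _ hr => (hr q hq).anti (inf_le_inf_right _ h)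

theorem closure_below_subset : C.closure (C.below s d) ⊆ C.below s d := fun p hp => by
  have h := hp ⊤ s d fun q (hq : C.Entails q s d) => by rwa [inf_top_eq]
  rwa [inf_top_eq] at h

theorem single_mem_below : single s d ∈ C.below s d := ⟨⊤, C.top_mem, le_top, by simp⟩

theorem below_subset (hZ : C.closure Z ⊆ Z) (h : single s d ∈ Z) : C.below s d ⊆ Z :=
  fun _ hp => hZ fun _ _ _ hr => Entails.cut hp (hr _ h)

theorem below_subset_below_not (hd : d ∈ C.carrier) : C.below s d ⊆ C.below (!s) d := by
  rintro p ⟨c, hc, h1, h2⟩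
  refine ⟨c ⇨ d, C.himp_mem hc hd, by simpa using h2, ?_⟩
  exact (inf_le_inf_right _ h1).trans inf_himp_le

variable (C)

/-- Interpretation of formulas as closed sets of contexts. -/
def interp (v : ℕ → Set (Bool → H)) : Form → Set (Bool → H)
  | .var n => v n
  | .bot => C.closure ∅
  | .and φ ψ => interp v φ ∩ interp v ψ
  | .or φ ψ => C.closure (interp v φ ∪ interp v ψ)
  | .imp φ ψ => {p | ∀ q ∈ interp v φ, p ⊓ q ∈ interp v ψ}
  | .box φ => C.closure {p | ∃ q ∈ interp v φ, ∀ i, p i ≤ box (q i)}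
  | .dia φ => C.closure
      {p | ∃ q ∈ interp v φ, ∃ i, p i ≤ dia (q i) ∧ p (!i) ≤ box (q (!i))}

variable {C} {v : ℕ → Set (Bool → H)}

theorem closure_interp_subset (hv : ∀ n, C.closure (v n) ⊆ v n) (φ : Form) :
    C.closure (C.interp v φ) ⊆ C.interp v φ := by
  induction φ with
  | var n => exact hv n
  | bot => exact closure_closure_subset
  | and φ ψ ihφ ihψ =>
    exact Set.subset_inter
      (fun p hp => ihφ fun r s f h => hp r s f fun q hq => h q hq.1)
      (fun p hp => ihψ fun r s f h => hp r s f fun q hq => h q hq.2)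
  | or φ ψ => exact closure_closure_subset
  | imp φ ψ ihφ ihψ =>
    exact fun p hp q hq =>
      inf_mem_of_mem_closure (X := C.interp v (φ.imp ψ)) ihψ (fun x hx => hx q hq) hp
  | box φ => exact closure_closure_subset
  | dia φ => exact closure_closure_subset

theorem mem_interp_of_ax (hv : ∀ n, C.closure (v n) ⊆ v n) {φ : Form} (h : CKAx φ)
    (p : Bool → H) : p ∈ C.interp v φ := by
  have cl := closure_interp_subset hv
  cases h with
  | a1 φ ψ =>
    intro q hq r hr
    exact mem_of_le (cl _) hq (inf_le_left.trans inf_le_right)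
  | a2 φ ψ χ =>
    intro x hx y hy z hz
    refine mem_of_le (cl χ) (hx z hz _ (hy z hz)) ?_
    refine le_inf (inf_le_inf_right _ (inf_le_left.trans inf_le_right)) ?_
    exact inf_le_inf_right _ inf_le_right
  | a3 φ ψ =>
    intro x hx
    exact mem_of_le (cl _) (subset_closure (Or.inl hx)) inf_le_right
  | a4 φ ψ =>
    intro x hx
    exact mem_of_le (cl _) (subset_closure (Or.inr hx)) inf_le_right
  | a5 φ ψ χ =>
    intro x hx y hy z hz
    rw [inf_comm]
    refine inf_mem_of_mem_closure (cl χ) ?_ hz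
    rintro w (hw | hw)
    · refine mem_of_le (cl χ) (hx w hw) (le_inf ?_ inf_le_left)
      exact inf_le_right.trans (inf_le_left.trans inf_le_right)
    · exact mem_of_le (cl χ) (hy w hw) (le_inf (inf_le_right.trans inf_le_right) inf_le_left)
  | a6 φ ψ =>
    intro x hx
    exact mem_of_le (cl _) hx.1 inf_le_right
  | a7 φ ψ =>
    intro x hx
    exact mem_of_le (cl _) hx.2 inf_le_right
  | a8 φ ψ χ =>
    intro x hx y hy z hz
    refine ⟨mem_of_le (cl _) (hx z hz) ?_, mem_of_le (cl _) (hy z hz) ?_⟩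
    · exact inf_le_inf_right _ (inf_le_left.trans inf_le_right)
    · exact inf_le_inf_right _ inf_le_right
  | a9 φ =>
    intro x hx
    exact mem_of_le (cl _) (closure_subset (cl φ) (Set.empty_subset _) hx) inf_le_right
  | kbox φ ψ =>
    intro x hx y hy
    rw [inf_comm p x, inf_assoc]
    refine inf_mem_of_mem_closure (cl ψ.box) ?_ hx
    rintro w ⟨a, ha, hwa⟩
    refine mem_of_le (q := y ⊓ w) (cl ψ.box) ?_
      (le_inf (inf_le_right.trans inf_le_right) inf_le_left)
    refine inf_mem_of_mem_closure (cl ψ.box) ?_ hy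
    rintro z ⟨b, hb, hzb⟩
    exact subset_closure ⟨a ⊓ b, ha b hb, fun i =>
      (le_inf (inf_le_right.trans (hwa i)) (inf_le_left.trans (hzb i))).trans
        (box_inf_box_le _ _)⟩
  | kdia φ ψ =>
    intro x hx y hy
    rw [inf_comm p x, inf_assoc]
    refine inf_mem_of_mem_closure (cl ψ.dia) ?_ hx
    rintro w ⟨a, ha, hwa⟩
    refine mem_of_le (q := y ⊓ w) (cl ψ.dia) ?_
      (le_inf (inf_le_right.trans inf_le_right) inf_le_left)
    refine inf_mem_of_mem_closure (cl ψ.dia) ?_ hy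
    rintro z ⟨b, hb, i, hi, hi'⟩
    exact subset_closure ⟨a ⊓ b, ha b hb, i,
      (le_inf (inf_le_right.trans (hwa i)) (inf_le_left.trans hi)).trans (box_inf_dia_le _ _),
      (le_inf (inf_le_right.trans (hwa _)) (inf_le_left.trans hi')).trans (box_inf_box_le _ _)⟩

theorem mem_interp_of_provable (hv : ∀ n, C.closure (v n) ⊆ v n) {Γ : Set Form} {φ : Form}
    (h : CKH Γ φ) (hΓ : ∀ γ ∈ Γ, ∀ p, p ∈ C.interp v γ) (p : Bool → H) :
    p ∈ C.interp v φ := by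
  induction h generalizing p with
  | ax h => exact mem_interp_of_ax hv h p
  | el h => exact hΓ _ h p
  | mp _ _ ih ih' => simpa using ih' hΓ p p (ih hΓ p)
  | nec _ ih =>
    exact subset_closure ⟨⊤, ih (by simp) ⊤, fun i => by simp [box_top]⟩

theorem interp_eq_below {V : Bool → Set ℕ} {m : Form → H}
    (hbot : m .bot = ⊥) (hand : ∀ φ ψ, m (.and φ ψ) = m φ ⊓ m ψ)
    (hor : ∀ φ ψ, m (.or φ ψ) = m φ ⊔ m ψ) (himp : ∀ φ ψ, m (.imp φ ψ) = m φ ⇨ m ψ)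
    (hbox : ∀ φ, m (.box φ) = box (m φ)) (hdia : ∀ φ, m (.dia φ) = dia (m φ))
    (hvar : ∀ s, ∀ n ∈ V s, v n = C.below s (m (.var n))) (φ : Form) (hφ : vars φ ⊆ V s) :
    C.interp v φ = C.below s (m φ) := by
  induction φ with
  | var n => exact hvar s n (hφ rfl)
  | bot =>
    rw [hbot]
    refine (closure_subset closure_below_subset (Set.empty_subset _)).antisymm fun p hp => ?_
    exact fun r t f _ => Entails.cut hp entails_single_bot
  | and φ ψ ihφ ihψ =>
    rw [vars, Set.union_subset_iff] at hφ
    rw [interp, ihφ hφ.1, ihψ hφ.2, hand]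
    ext p
    constructor
    · rintro ⟨⟨c, hc, h1, h2⟩, ⟨c', hc', h3, h4⟩⟩
      refine ⟨c ⊓ c', C.inf_mem hc hc', le_inf h1 h3, le_inf ?_ ?_⟩
      · exact (inf_le_inf_left _ inf_le_left).trans h2
      · exact (inf_le_inf_left _ inf_le_right).trans h4
    · rintro ⟨c, hc, h1, h2⟩
      exact ⟨⟨c, hc, h1, h2.trans inf_le_left⟩, ⟨c, hc, h1, h2.trans inf_le_right⟩⟩
  | or φ ψ ihφ ihψ =>
    rw [vars, Set.union_subset_iff] at hφ
    rw [interp, ihφ hφ.1, ihψ hφ.2, hor]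
    refine (closure_subset closure_below_subset (Set.union_subset ?_ ?_)).antisymm ?_
    · rintro p ⟨c, hc, h1, h2⟩
      exact ⟨c, hc, h1, h2.trans le_sup_left⟩
    · rintro p ⟨c, hc, h1, h2⟩
      exact ⟨c, hc, h1, h2.trans le_sup_right⟩
    · exact fun p hp r t f h => Entails.cut hp <|
        (h _ (Or.inl single_mem_below)).single_sup (h _ (Or.inr single_mem_below))
  | imp φ ψ ihφ ihψ =>
    rw [vars, Set.union_subset_iff] at hφ
    rw [interp, ihφ hφ.1, ihψ hφ.2, himp]
    ext p
    constructor
    · intro h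
      obtain ⟨c, hc, h1, h2⟩ := h _ single_mem_below
      refine ⟨c, hc, by simpa using h1, ?_⟩
      rw [le_himp_iff, inf_right_comm]
      simpa using h2
    · rintro ⟨c, hc, h1, h2⟩ q ⟨c', hc', h3, h4⟩
      refine ⟨c ⊓ c', C.inf_mem hc hc', inf_le_inf h1 h3, ?_⟩
      rw [Pi.inf_apply, inf_inf_inf_comm]
      exact (inf_le_inf h2 h4).trans himp_inf_le
  | box φ ih =>
    rw [interp, ih hφ, hbox]
    refine (closure_subset closure_below_subset ?_).antisymm
      (below_subset closure_closure_subset ?_)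
    · rintro p ⟨q, ⟨c, hc, h1, h2⟩, h⟩
      refine ⟨box c, C.box_mem hc, (h _).trans (box_mono h1), ?_⟩
      exact (inf_le_inf_right _ (h s)).trans ((box_inf_box_le _ _).trans (box_mono h2))
    · refine subset_closure ⟨single s (m φ), single_mem_below, fun i => ?_⟩
      rcases Bool.eq_or_eq_not i s with rfl | rfl <;> simp [box_top]
  | dia φ ih =>
    rw [interp, ih hφ, hdia]
    refine (closure_subset closure_below_subset ?_).antisymm
      (below_subset closure_closure_subset ?_)
    · rintro p ⟨q, ⟨c, hc, h1, h2⟩, i, hi, hi'⟩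
      rcases Bool.eq_or_eq_not i s with rfl | rfl
      · refine ⟨box c, C.box_mem hc, hi'.trans (box_mono h1), ?_⟩
        rw [inf_comm] at h2 ⊢
        exact (inf_le_inf_left _ hi).trans ((box_inf_dia_le _ _).trans (dia_mono h2))
      · rw [Bool.not_not] at hi'
        refine ⟨dia c, C.dia_mem hc, hi.trans (dia_mono h1), ?_⟩
        exact (inf_le_inf_right _ hi').trans ((box_inf_dia_le _ _).trans (dia_mono h2))
    · exact subset_closure ⟨single s (m φ), single_mem_below, s, by simp, by simp [box_top]⟩

end CKSubalgebra

namespace CKH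

variable {Γ : Set Form} {φ ψ χ : Form}

theorem imp_of (ψ : Form) (h : CKH Γ φ) : CKH Γ (ψ.imp φ) := h.mp (ax (.a1 _ _))

theorem mp₂ (h : CKH Γ (χ.imp (φ.imp ψ))) (h' : CKH Γ (χ.imp φ)) : CKH Γ (χ.imp ψ) :=
  h'.mp (h.mp (ax (.a2 _ _ _)))

theorem imp_self (φ : Form) : CKH Γ (φ.imp φ) :=
  mp₂ (ax (.a1 φ (φ.imp φ))) (ax (.a1 _ _))

theorem imp_trans (h : CKH Γ (φ.imp ψ)) (h' : CKH Γ (ψ.imp χ)) : CKH Γ (φ.imp χ) :=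
  mp₂ (h'.imp_of φ) h

theorem imp_and (h : CKH Γ (φ.imp ψ)) (h' : CKH Γ (φ.imp χ)) : CKH Γ (φ.imp (ψ.and χ)) :=
  h'.mp (h.mp (ax (.a8 _ _ _)))

theorem curry (h : CKH Γ ((φ.and ψ).imp χ)) : CKH Γ (φ.imp (ψ.imp χ)) := by
  have h1 : CKH Γ (φ.imp (ψ.imp (φ.and ψ))) :=
    mp₂ (imp_trans (ax (.a1 φ ψ)) (ax (.a8 ψ φ ψ))) ((imp_self ψ).imp_of φ)
  exact imp_trans h1 ((h.imp_of ψ).mp (ax (.a2 _ _ _)))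

theorem uncurry (h : CKH Γ (φ.imp (ψ.imp χ))) : CKH Γ ((φ.and ψ).imp χ) :=
  mp₂ (imp_trans (ax (.a6 _ _)) h) (ax (.a7 _ _))

theorem box_imp_box (h : CKH ∅ (φ.imp ψ)) : CKH Γ (φ.box.imp ψ.box) :=
  (nec h).mp (ax (.kbox _ _))

theorem dia_imp_dia (h : CKH ∅ (φ.imp ψ)) : CKH Γ (φ.dia.imp ψ.dia) :=
  (nec h).mp (ax (.kdia _ _))

end CKH

namespace Form

/-- Formulas preordered by provable implication in CK. -/
instance : Preorder Form where
  le φ ψ := CKH ∅ (φ.imp ψ)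
  le_refl := CKH.imp_self
  le_trans _ _ _ := CKH.imp_trans

theorem imp_mono {φ φ' ψ ψ' : Form} (h : φ' ≤ φ) (h' : ψ ≤ ψ') : φ.imp ψ ≤ φ'.imp ψ' :=
  CKH.curry (CKH.imp_trans (CKH.mp₂ (.ax (.a6 _ _)) (CKH.imp_trans (.ax (.a7 _ _)) h)) h')

theorem and_mono {φ φ' ψ ψ' : Form} (h : φ ≤ φ') (h' : ψ ≤ ψ') : φ.and ψ ≤ φ'.and ψ' :=
  CKH.imp_and (CKH.imp_trans (.ax (.a6 _ _)) h) (CKH.imp_trans (.ax (.a7 _ _)) h')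

theorem or_le {φ ψ χ : Form} (h : φ ≤ χ) (h' : ψ ≤ χ) : φ.or ψ ≤ χ :=
  CKH.mp h' (CKH.mp h (.ax (.a5 _ _ _)))

theorem or_mono {φ φ' ψ ψ' : Form} (h : φ ≤ φ') (h' : ψ ≤ ψ') : φ.or ψ ≤ φ'.or ψ' :=
  or_le (CKH.imp_trans h (.ax (.a3 _ _))) (CKH.imp_trans h' (.ax (.a4 _ _)))

end Form

/-- The Lindenbaum algebra of CK. -/
abbrev Lindenbaum : Type := Antisymmetrization Form (· ≤ ·)

namespace Lindenbaum

/-- The class of a formula. -/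
abbrev mk (φ : Form) : Lindenbaum := toAntisymmetrization (· ≤ ·) φ

theorem mk_le_mk {φ ψ : Form} : mk φ ≤ mk ψ ↔ CKH ∅ (φ.imp ψ) := Iff.rfl

/-- Implication on the Lindenbaum algebra. -/
def imp : Lindenbaum → Lindenbaum → Lindenbaum :=
  Quotient.map₂ Form.imp fun _ _ h _ _ h' =>
    ⟨Form.imp_mono h.2 h'.1, Form.imp_mono h.1 h'.2⟩

instance : CKAlgebra Lindenbaum where
  inf := Quotient.map₂ Form.and fun _ _ h _ _ h' =>
    ⟨Form.and_mono h.1 h'.1, Form.and_mono h.2 h'.2⟩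
  sup := Quotient.map₂ Form.or fun _ _ h _ _ h' =>
    ⟨Form.or_mono h.1 h'.1, Form.or_mono h.2 h'.2⟩
  himp := imp
  compl a := imp a (mk .bot)
  box := Quotient.map Form.box fun _ _ h => ⟨CKH.box_imp_box h.1, CKH.box_imp_box h.2⟩
  dia := Quotient.map Form.dia fun _ _ h => ⟨CKH.dia_imp_dia h.1, CKH.dia_imp_dia h.2⟩
  top := mk (.imp .bot .bot)
  bot := mk .bot
  inf_le_left := by rintro ⟨φ⟩ ⟨ψ⟩; exact CKH.ax (.a6 φ ψ)
  inf_le_right := by rintro ⟨φ⟩ ⟨ψ⟩; exact CKH.ax (.a7 φ ψ)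
  le_inf := by rintro ⟨φ⟩ ⟨ψ⟩ ⟨χ⟩ h h'; exact CKH.imp_and h h'
  le_sup_left := by rintro ⟨φ⟩ ⟨ψ⟩; exact CKH.ax (.a3 φ ψ)
  le_sup_right := by rintro ⟨φ⟩ ⟨ψ⟩; exact CKH.ax (.a4 φ ψ)
  sup_le := by rintro ⟨φ⟩ ⟨ψ⟩ ⟨χ⟩ h h'; exact Form.or_le h h'
  le_top := by rintro ⟨φ⟩; exact CKH.imp_of φ (CKH.imp_self .bot)
  bot_le := by rintro ⟨φ⟩; exact CKH.ax (.a9 φ)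
  le_himp_iff := by rintro ⟨φ⟩ ⟨ψ⟩ ⟨χ⟩; exact ⟨CKH.uncurry, CKH.curry⟩
  himp_bot := by rintro ⟨φ⟩; rfl
  box_top := le_antisymm (CKH.imp_of _ (CKH.imp_self .bot))
    (CKH.imp_of _ (CKH.nec (CKH.imp_self .bot)))
  box_mono := by rintro ⟨φ⟩ ⟨ψ⟩ h; exact CKH.box_imp_box h
  dia_mono := by rintro ⟨φ⟩ ⟨ψ⟩ h; exact CKH.dia_imp_dia h
  box_inf_box_le := by
    rintro ⟨φ⟩ ⟨ψ⟩
    exact CKH.uncurry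
      (CKH.imp_trans (CKH.box_imp_box (CKH.curry (CKH.imp_self _))) (.ax (.kbox _ _)))
  box_inf_dia_le := by
    rintro ⟨φ⟩ ⟨ψ⟩
    exact CKH.uncurry
      (CKH.imp_trans (CKH.box_imp_box (CKH.curry (CKH.imp_self _))) (.ax (.kdia _ _)))

/-- The subalgebra of classes of formulas with variables in `V`. -/
def ofVars (V : Set ℕ) : CKSubalgebra Lindenbaum where
  carrier := {a | ∃ φ, vars φ ⊆ V ∧ mk φ = a}
  bot_mem := ⟨.bot, Set.empty_subset _, rfl⟩
  inf_mem := by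
    rintro _ _ ⟨φ, h, rfl⟩ ⟨ψ, h', rfl⟩
    exact ⟨φ.and ψ, Set.union_subset h h', rfl⟩
  sup_mem := by
    rintro _ _ ⟨φ, h, rfl⟩ ⟨ψ, h', rfl⟩
    exact ⟨φ.or ψ, Set.union_subset h h', rfl⟩
  himp_mem := by
    rintro _ _ ⟨φ, h, rfl⟩ ⟨ψ, h', rfl⟩
    exact ⟨φ.imp ψ, Set.union_subset h h', rfl⟩
  box_mem := by
    rintro _ ⟨φ, h, rfl⟩
    exact ⟨φ.box, h, rfl⟩
  dia_mem := by
    rintro _ ⟨φ, h, rfl⟩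
    exact ⟨φ.dia, h, rfl⟩

end Lindenbaum

/-- The logic CK has the Craig interpolation property. -/
theorem CK_craig_interpolation :
    ∀ φ ψ : Form, CKH ∅ (φ.imp ψ) →
      ∃ θ : Form, vars θ ⊆ vars φ ∩ vars ψ ∧
        CKH ∅ (φ.imp θ) ∧ CKH ∅ (θ.imp ψ) := by
  classical
  intro φ ψ h
  let V : Bool → Set ℕ := fun s => if s then vars φ else vars ψ
  let C := Lindenbaum.ofVars (vars φ ∩ vars ψ)
  let v : ℕ → Set (Bool → Lindenbaum) := fun n => C.below (decide (n ∈ vars φ)) (.mk (.var n))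
  have hv : ∀ n, C.closure (v n) ⊆ v n := fun n => CKSubalgebra.closure_below_subset
  have hvar : ∀ s, ∀ n ∈ V s, v n = C.below s (.mk (.var n)) := by
    rintro (_ | _) n hn
    · by_cases hφ : n ∈ vars φ
      · have hC : Lindenbaum.mk (.var n) ∈ C.carrier :=
          ⟨.var n, Set.singleton_subset_iff.2 ⟨hφ, hn⟩, rfl⟩
        simp only [v, hφ, decide_true]
        exact (CKSubalgebra.below_subset_below_not hC).antisymm
          (CKSubalgebra.below_subset_below_not hC)
      · simp [v, hφ]
    · have hφ : n ∈ vars φ := hn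
      simp [v, hφ]
  have hE (s : Bool) (χ : Form) (hχ : vars χ ⊆ V s) : C.interp v χ = C.below s (.mk χ) :=
    CKSubalgebra.interp_eq_below rfl (fun _ _ => rfl) (fun _ _ => rfl) (fun _ _ => rfl) (fun _ => rfl)
      (fun _ => rfl) hvar χ hχ
  have key := CKSubalgebra.mem_interp_of_provable hv h (by simp) ⊤
    (CKSubalgebra.single true (.mk φ))
    (by rw [hE true φ subset_rfl]; exact CKSubalgebra.single_mem_below)
  rw [hE false ψ subset_rfl, top_inf_eq] at key
  obtain ⟨_, ⟨θ, hθ, rfl⟩, h1, h2⟩ := key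
  refine ⟨θ, hθ, Lindenbaum.mk_le_mk.1 (by simpa using h1), Lindenbaum.mk_le_mk.1 ?_⟩
  have : CKSubalgebra.single true (Lindenbaum.mk φ) false = ⊤ := CKSubalgebra.single_not true _
  simpa [this] using h2
end

section
/- The logic WK has the Craig interpolation property: for all formulas φ and ψ, if ⊢_WK φ → ψ then there exists a formula θ with vars(θ) ⊆ vars(φ) ∩ vars(ψ) such that ⊢_WK φ → θ and ⊢_WK θ → ψ. -/
/-- The set of formulas whose box lies in `Γ`. -/
def unbox (Γ : Set Form) : Set Form := {φ | φ.box ∈ Γ}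

theorem mem_unbox {Γ : Set Form} {φ : Form} : φ ∈ unbox Γ ↔ φ.box ∈ Γ := Iff.rfl

theorem unbox_mono {Γ Δ : Set Form} (h : Γ ⊆ Δ) : unbox Γ ⊆ unbox Δ := fun _ hφ => h hφ

/-- The set of formulas with variables in `L`. -/
def formsOver (L : Set ℕ) : Set Form := {φ | vars φ ⊆ L}

theorem unbox_subset_formsOver {Γ : Set Form} {L : Set ℕ} (h : Γ ⊆ formsOver L) :
    unbox Γ ⊆ formsOver L := fun φ hφ => h (a := φ.box) hφ

theorem mem_formsOver_of_dia {φ : Form} {L : Set ℕ} (h : φ.dia ∈ formsOver L) :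
    φ ∈ formsOver L := h

namespace WKH

theorem mono {Γ Δ : Set Form} {φ : Form} (h : WKH Γ φ) (hs : Γ ⊆ Δ) : WKH Δ φ := by
  induction h with
  | ax h => exact .ax h
  | el h => exact .el (hs h)
  | mp _ _ ih₁ ih₂ => exact .mp (ih₁ hs) (ih₂ hs)
  | nec h _ => exact .nec h

theorem of_ck {Γ : Set Form} {φ : Form} (h : CKAx φ) : WKH Γ φ := .ax (.ck h)

theorem imp_self (Γ : Set Form) (φ : Form) : WKH Γ (φ.imp φ) :=
  .mp (of_ck (.a1 φ φ)) (.mp (of_ck (.a1 φ (φ.imp φ))) (of_ck (.a2 _ _ _)))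

theorem imp_of {Γ : Set Form} {φ : Form} (ψ : Form) (h : WKH Γ φ) : WKH Γ (ψ.imp φ) :=
  .mp h (of_ck (.a1 _ _))

theorem deduction {Γ : Set Form} {φ ψ : Form} (h : WKH (insert φ Γ) ψ) : WKH Γ (φ.imp ψ) := by
  generalize hΔ : insert φ Γ = Δ at h
  induction h with
  | ax h => exact imp_of _ (.ax h)
  | el h =>
    subst hΔ
    rcases h with rfl | h
    · exact imp_self _ _
    · exact imp_of _ (.el h)
  | mp _ _ ih₁ ih₂ => exact .mp (ih₁ hΔ) (.mp (ih₂ hΔ) (of_ck (.a2 _ _ _)))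
  | nec h _ => exact imp_of _ (.nec h)

theorem cut {Γ Δ : Set Form} {φ ψ : Form} (h : WKH Γ φ) (h' : WKH Δ ψ)
    (hs : Δ ⊆ insert φ Γ) : WKH Γ ψ :=
  .mp h (deduction (h'.mono hs))

theorem and_intro {Γ : Set Form} {φ ψ : Form} (h₁ : WKH Γ φ) (h₂ : WKH Γ ψ) :
    WKH Γ (φ.and ψ) :=
  .mp (imp_self Γ .bot)
    (.mp (imp_of _ h₂) (.mp (imp_of _ h₁) (of_ck (.a8 (Form.bot.imp .bot) _ _))))

theorem and_left {Γ : Set Form} {φ ψ : Form} (h : WKH Γ (φ.and ψ)) : WKH Γ φ :=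
  .mp h (of_ck (.a6 _ _))

theorem and_right {Γ : Set Form} {φ ψ : Form} (h : WKH Γ (φ.and ψ)) : WKH Γ ψ :=
  .mp h (of_ck (.a7 _ _))

theorem or_left {Γ : Set Form} {φ : Form} (ψ : Form) (h : WKH Γ φ) : WKH Γ (φ.or ψ) :=
  .mp h (of_ck (.a3 _ _))

theorem or_right {Γ : Set Form} {ψ : Form} (φ : Form) (h : WKH Γ ψ) : WKH Γ (φ.or ψ) :=
  .mp h (of_ck (.a4 _ _))

theorem or_elim {Γ : Set Form} {φ ψ χ : Form} (h : WKH Γ (φ.or ψ))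
    (h₁ : WKH (insert φ Γ) χ) (h₂ : WKH (insert ψ Γ) χ) : WKH Γ χ :=
  .mp h (.mp (deduction h₂) (.mp (deduction h₁) (of_ck (.a5 _ _ _))))

theorem exfalso {Γ : Set Form} (φ : Form) (h : WKH Γ .bot) : WKH Γ φ :=
  .mp h (of_ck (.a9 _))

theorem box_of_forall {Γ Δ : Set Form} {φ : Form} (h : WKH Γ φ)
    (hΓ : ∀ γ ∈ Γ, WKH Δ γ.box) : WKH Δ φ.box := by
  induction h with
  | ax h => exact .nec (.ax h)
  | el h => exact hΓ _ h
  | mp _ _ ih₁ ih₂ => exact .mp (ih₁ hΓ) (.mp (ih₂ hΓ) (of_ck (.kbox _ _)))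
  | nec h _ => exact .nec (.nec h)

theorem box_of_unbox {Γ : Set Form} {φ : Form} (h : WKH (unbox Γ) φ) : WKH Γ φ.box :=
  box_of_forall h fun _ hγ => .el hγ

theorem dia_of_unbox {Γ : Set Form} {φ ψ : Form} (hφ : WKH Γ φ.dia)
    (h : WKH (insert φ (unbox Γ)) ψ) : WKH Γ ψ.dia :=
  .mp hφ (.mp (box_of_unbox (deduction h)) (of_ck (.kdia _ _)))

end WKH

/-- A cut-free sequent calculus for WK with sets as antecedents; the succedent `⊥` plays the role
of the empty succedent. -/
inductive CutFree : Set Form → Form → Prop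
  | id {Γ : Set Form} {φ : Form} : φ ∈ Γ → CutFree Γ φ
  | exfalso {Γ : Set Form} {φ : Form} : CutFree Γ .bot → CutFree Γ φ
  | andL {Γ : Set Form} {φ ψ δ : Form} : φ.and ψ ∈ Γ →
      CutFree (insert φ (insert ψ Γ)) δ → CutFree Γ δ
  | andR {Γ : Set Form} {φ ψ : Form} : CutFree Γ φ → CutFree Γ ψ → CutFree Γ (φ.and ψ)
  | orL {Γ : Set Form} {φ ψ δ : Form} : φ.or ψ ∈ Γ →
      CutFree (insert φ Γ) δ → CutFree (insert ψ Γ) δ → CutFree Γ δ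
  | orR₁ {Γ : Set Form} {φ ψ : Form} : CutFree Γ φ → CutFree Γ (φ.or ψ)
  | orR₂ {Γ : Set Form} {φ ψ : Form} : CutFree Γ ψ → CutFree Γ (φ.or ψ)
  | impL {Γ : Set Form} {φ ψ δ : Form} : φ.imp ψ ∈ Γ →
      CutFree Γ φ → CutFree (insert ψ Γ) δ → CutFree Γ δ
  | impR {Γ : Set Form} {φ ψ : Form} : CutFree (insert φ Γ) ψ → CutFree Γ (φ.imp ψ)
  | boxR {Γ : Set Form} {φ : Form} : CutFree (unbox Γ) φ → CutFree Γ φ.box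
  | dia {Γ : Set Form} {φ ψ : Form} : φ.dia ∈ Γ →
      CutFree (insert φ (unbox Γ)) ψ → CutFree Γ ψ.dia
  | diaBot {Γ : Set Form} {φ : Form} : φ.dia ∈ Γ →
      CutFree (insert φ (unbox Γ)) .bot → CutFree Γ .bot

namespace CutFree

theorem mono {Γ Δ : Set Form} {φ : Form} (h : CutFree Γ φ) (hs : Γ ⊆ Δ) : CutFree Δ φ := by
  induction h generalizing Δ with
  | id h => exact .id (hs h)
  | exfalso _ ih => exact .exfalso (ih hs)
  | andL h _ ih =>
    exact .andL (hs h) (ih (Set.insert_subset_insert (Set.insert_subset_insert hs)))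
  | andR _ _ ih₁ ih₂ => exact .andR (ih₁ hs) (ih₂ hs)
  | orL h _ _ ih₁ ih₂ =>
    exact .orL (hs h) (ih₁ (Set.insert_subset_insert hs)) (ih₂ (Set.insert_subset_insert hs))
  | orR₁ _ ih => exact .orR₁ (ih hs)
  | orR₂ _ ih => exact .orR₂ (ih hs)
  | impL h _ _ ih₁ ih₂ => exact .impL (hs h) (ih₁ hs) (ih₂ (Set.insert_subset_insert hs))
  | impR _ ih => exact .impR (ih (Set.insert_subset_insert hs))
  | boxR _ ih => exact .boxR (ih (unbox_mono hs))
  | dia h _ ih => exact .dia (hs h) (ih (Set.insert_subset_insert (unbox_mono hs)))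
  | diaBot h _ ih => exact .diaBot (hs h) (ih (Set.insert_subset_insert (unbox_mono hs)))

/-- Maehara's lemma: every partition of the antecedent of a cut-free derivable sequent admits an
interpolant. -/
theorem exists_interpolant {Γ : Set Form} {δ : Form} (h : CutFree Γ δ)
    {Γ₁ Γ₂ : Set Form} {L₁ L₂ : Set ℕ} (hΓ : Γ = Γ₁ ∪ Γ₂) (h₁ : Γ₁ ⊆ formsOver L₁)
    (h₂ : Γ₂ ⊆ formsOver L₂) (hδ : δ ∈ formsOver L₂) :
    ∃ θ : Form, vars θ ⊆ L₁ ∩ L₂ ∧ WKH Γ₁ θ ∧ WKH (insert θ Γ₂) δ := by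
  induction h generalizing Γ₁ Γ₂ L₁ L₂ with
  | @id _ φ h =>
    subst hΓ
    rcases h with h | h
    · exact ⟨φ, Set.subset_inter (h₁ h) hδ, .el h, .el (Set.mem_insert _ _)⟩
    · exact ⟨Form.bot.imp .bot, by simp [vars], WKH.imp_self _ _, .el (Set.mem_insert_of_mem _ h)⟩
  | exfalso _ ih =>
    obtain ⟨θ, hθ, hl, hr⟩ := ih hΓ h₁ h₂ (by simp [formsOver, vars])
    exact ⟨θ, hθ, hl, hr.exfalso _⟩
  | @andL _ φ ψ δ h _ ih =>
    subst hΓ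
    rcases h with h | h
    · have hv : vars φ ∪ vars ψ ⊆ L₁ := h₁ h
      rw [Set.union_subset_iff] at hv
      obtain ⟨θ, hθ, hl, hr⟩ := ih (Γ₁ := insert φ (insert ψ Γ₁)) (by grind)
        (Set.insert_subset hv.1 (Set.insert_subset hv.2 h₁)) h₂ hδ
      exact ⟨θ, hθ, .cut (WKH.el h).and_left
        (.cut (WKH.el (Set.mem_insert_of_mem _ h)).and_right hl (by grind)) subset_rfl, hr⟩
    · have hv : vars φ ∪ vars ψ ⊆ L₂ := h₂ h
      rw [Set.union_subset_iff] at hv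
      obtain ⟨θ, hθ, hl, hr⟩ := ih (Γ₂ := insert φ (insert ψ Γ₂)) (by grind) h₁
        (Set.insert_subset hv.1 (Set.insert_subset hv.2 h₂)) hδ
      have he : WKH (insert θ Γ₂) (φ.and ψ) := .el (Set.mem_insert_of_mem _ h)
      exact ⟨θ, hθ, hl, .cut he.and_left
        (.cut (he.mono (Set.subset_insert _ _)).and_right hr (by grind)) subset_rfl⟩
  | andR _ _ ih₁ ih₂ =>
    have hv := Set.union_subset_iff.1 hδ
    obtain ⟨θ₁, hθ₁, hl₁, hr₁⟩ := ih₁ hΓ h₁ h₂ hv.1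
    obtain ⟨θ₂, hθ₂, hl₂, hr₂⟩ := ih₂ hΓ h₁ h₂ hv.2
    have he : WKH (insert (θ₁.and θ₂) Γ₂) (θ₁.and θ₂) := .el (Set.mem_insert _ _)
    exact ⟨θ₁.and θ₂, Set.union_subset hθ₁ hθ₂, hl₁.and_intro hl₂,
      (he.and_left.cut hr₁ (by grind)).and_intro (he.and_right.cut hr₂ (by grind))⟩
  | @orL _ φ ψ δ h _ _ ih₁ ih₂ =>
    subst hΓ
    rcases h with h | h
    · have hv : vars φ ∪ vars ψ ⊆ L₁ := h₁ h
      rw [Set.union_subset_iff] at hv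
      obtain ⟨θ₁, hθ₁, hl₁, hr₁⟩ := ih₁ (Γ₁ := insert φ Γ₁) (by grind)
        (Set.insert_subset hv.1 h₁) h₂ hδ
      obtain ⟨θ₂, hθ₂, hl₂, hr₂⟩ := ih₂ (Γ₁ := insert ψ Γ₁) (by grind)
        (Set.insert_subset hv.2 h₁) h₂ hδ
      exact ⟨θ₁.or θ₂, Set.union_subset hθ₁ hθ₂,
        (WKH.el h).or_elim (hl₁.or_left _) (hl₂.or_right _),
        .or_elim (.el (Set.mem_insert _ _)) (hr₁.mono (by grind)) (hr₂.mono (by grind))⟩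
    · have hv : vars φ ∪ vars ψ ⊆ L₂ := h₂ h
      rw [Set.union_subset_iff] at hv
      obtain ⟨θ₁, hθ₁, hl₁, hr₁⟩ := ih₁ (Γ₂ := insert φ Γ₂) (by grind) h₁
        (Set.insert_subset hv.1 h₂) hδ
      obtain ⟨θ₂, hθ₂, hl₂, hr₂⟩ := ih₂ (Γ₂ := insert ψ Γ₂) (by grind) h₁
        (Set.insert_subset hv.2 h₂) hδ
      have he {χ : Form} : WKH (insert χ (insert (θ₁.and θ₂) Γ₂)) (θ₁.and θ₂) :=
        .el (by simp)
      exact ⟨θ₁.and θ₂, Set.union_subset hθ₁ hθ₂, hl₁.and_intro hl₂,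
        .or_elim (.el (Set.mem_insert_of_mem _ h))
          (he.and_left.cut hr₁ (by grind)) (he.and_right.cut hr₂ (by grind))⟩
  | orR₁ _ ih =>
    obtain ⟨θ, hθ, hl, hr⟩ := ih hΓ h₁ h₂ (Set.union_subset_iff.1 hδ).1
    exact ⟨θ, hθ, hl, hr.or_left _⟩
  | orR₂ _ ih =>
    obtain ⟨θ, hθ, hl, hr⟩ := ih hΓ h₁ h₂ (Set.union_subset_iff.1 hδ).2
    exact ⟨θ, hθ, hl, hr.or_right _⟩
  | @impL _ φ ψ δ h _ _ ih₁ ih₂ =>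
    subst hΓ
    rcases h with h | h
    · have hv : vars φ ∪ vars ψ ⊆ L₁ := h₁ h
      rw [Set.union_subset_iff] at hv
      obtain ⟨θ₁, hθ₁, hl₁, hr₁⟩ := ih₁ (Set.union_comm _ _) h₂ h₁ hv.1
      obtain ⟨θ₂, hθ₂, hl₂, hr₂⟩ := ih₂ (Γ₁ := insert ψ Γ₁) (by grind)
        (Set.insert_subset hv.2 h₁) h₂ hδ
      refine ⟨θ₁.imp θ₂, Set.union_subset (hθ₁.trans (Set.inter_comm _ _).subset) hθ₂,
        .deduction ?_, ?_⟩
      · exact (hr₁.mp (.el (Set.mem_insert_of_mem _ h))).cut hl₂ (by grind)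
      · exact ((hl₁.mono (Set.subset_insert _ _)).mp (.el (Set.mem_insert _ _))).cut hr₂
          (by grind)
    · have hv : vars φ ∪ vars ψ ⊆ L₂ := h₂ h
      rw [Set.union_subset_iff] at hv
      obtain ⟨θ₁, hθ₁, hl₁, hr₁⟩ := ih₁ rfl h₁ h₂ hv.1
      obtain ⟨θ₂, hθ₂, hl₂, hr₂⟩ := ih₂ (Γ₂ := insert ψ Γ₂) (by grind) h₁
        (Set.insert_subset hv.2 h₂) hδ
      have he : WKH (insert (θ₁.and θ₂) Γ₂) (θ₁.and θ₂) := .el (Set.mem_insert _ _)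
      have hφ : WKH (insert (θ₁.and θ₂) Γ₂) φ := he.and_left.cut hr₁ (by grind)
      have hψ := hφ.mp (.el (Set.mem_insert_of_mem _ h))
      exact ⟨θ₁.and θ₂, Set.union_subset hθ₁ hθ₂, hl₁.and_intro hl₂,
        he.and_right.cut ((hψ.mono (Set.subset_insert _ _)).cut hr₂ (by grind)) subset_rfl⟩
  | @impR _ φ ψ _ ih =>
    subst hΓ
    have hv := Set.union_subset_iff.1 hδ
    obtain ⟨θ, hθ, hl, hr⟩ := ih (Γ₂ := insert φ Γ₂) (by grind) h₁
      (Set.insert_subset hv.1 h₂) hv.2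
    exact ⟨θ, hθ, hl, .deduction (hr.mono (by grind))⟩
  | boxR _ ih =>
    subst hΓ
    obtain ⟨θ, hθ, hl, hr⟩ := ih (Γ₁ := unbox Γ₁) (Γ₂ := unbox Γ₂) rfl
      (unbox_subset_formsOver h₁) (unbox_subset_formsOver h₂) hδ
    exact ⟨θ.box, hθ, hl.box_of_unbox, (hr.mono (by grind [mem_unbox])).box_of_unbox⟩
  | @dia _ γ _ h _ ih =>
    subst hΓ
    rcases h with h | h
    · obtain ⟨θ, hθ, hl, hr⟩ := ih (Γ₁ := insert γ (unbox Γ₁)) (Γ₂ := unbox Γ₂)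
        (by ext; grind [mem_unbox]) (Set.insert_subset (mem_formsOver_of_dia (h₁ h))
          (unbox_subset_formsOver h₁)) (unbox_subset_formsOver h₂) hδ
      exact ⟨θ.dia, hθ, .dia_of_unbox (.el h) hl,
        .dia_of_unbox (.el (Set.mem_insert _ _)) (hr.mono (by grind [mem_unbox]))⟩
    · obtain ⟨θ, hθ, hl, hr⟩ := ih (Γ₁ := unbox Γ₁) (Γ₂ := insert γ (unbox Γ₂))
        (by ext; grind [mem_unbox]) (unbox_subset_formsOver h₁)
        (Set.insert_subset (mem_formsOver_of_dia (h₂ h)) (unbox_subset_formsOver h₂)) hδ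
      exact ⟨θ.box, hθ, hl.box_of_unbox,
        .dia_of_unbox (.el (Set.mem_insert_of_mem _ h)) (hr.mono (by grind [mem_unbox]))⟩
  | @diaBot _ γ h _ ih =>
    subst hΓ
    rcases h with h | h
    · obtain ⟨θ, hθ, hl, hr⟩ := ih (Γ₁ := insert γ (unbox Γ₁)) (Γ₂ := unbox Γ₂)
        (by ext; grind [mem_unbox]) (Set.insert_subset (mem_formsOver_of_dia (h₁ h))
          (unbox_subset_formsOver h₁)) (unbox_subset_formsOver h₂) hδ
      exact ⟨θ.dia, hθ, .dia_of_unbox (.el h) hl,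
        (WKH.dia_of_unbox (.el (Set.mem_insert _ _)) (hr.mono (by grind [mem_unbox]))).mp (.ax .n)⟩
    · obtain ⟨θ, hθ, hl, hr⟩ := ih (Γ₁ := unbox Γ₁) (Γ₂ := insert γ (unbox Γ₂))
        (by ext; grind [mem_unbox]) (unbox_subset_formsOver h₁)
        (Set.insert_subset (mem_formsOver_of_dia (h₂ h)) (unbox_subset_formsOver h₂)) hδ
      exact ⟨θ.box, hθ, hl.box_of_unbox,
        (WKH.dia_of_unbox (.el (Set.mem_insert_of_mem _ h))
          (hr.mono (by grind [mem_unbox]))).mp (.ax .n)⟩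

end CutFree

/-- The closure of a set of contexts under cut-free derivability: `Γ` lies in it when every
sequent that is derivable over all contexts in `X` is derivable over `Γ`. -/
def contextClosure (X : Set (Set Form)) : Set (Set Form) :=
  {Γ | ∀ (S : Set Form) (δ : Form), (∀ Δ ∈ X, CutFree (Δ ∪ S) δ) → CutFree (Γ ∪ S) δ}

theorem subset_contextClosure (X : Set (Set Form)) : X ⊆ contextClosure X :=
  fun _ hΓ _ _ h => h _ hΓ

theorem contextClosure_mono {X Y : Set (Set Form)} (h : X ⊆ Y) :
    contextClosure X ⊆ contextClosure Y :=
  fun _ hΓ _ _ hY => hΓ _ _ fun _ hΔ => hY _ (h hΔ)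

theorem contextClosure_idem (X : Set (Set Form)) :
    contextClosure (contextClosure X) ⊆ contextClosure X :=
  fun _ hΓ _ _ hX => hΓ _ _ fun _ hΔ => hΔ _ _ hX

theorem isUpperSet_contextClosure (X : Set (Set Form)) : IsUpperSet (contextClosure X) :=
  fun _ _ hs hΓ _ _ hX => (hΓ _ _ hX).mono (Set.union_subset_union_left _ hs)

theorem contextClosure_inter {X Y : Set (Set Form)} (hX : IsUpperSet X) (hY : IsUpperSet Y)
    {Γ : Set Form} (h₁ : Γ ∈ contextClosure X) (h₂ : Γ ∈ contextClosure Y) :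
    Γ ∈ contextClosure (X ∩ Y) := by
  intro S δ h
  have key : CutFree (Γ ∪ (Γ ∪ S)) δ := by
    refine h₁ _ _ fun Δ hΔ => ?_
    have : CutFree (Γ ∪ (Δ ∪ S)) δ := by
      refine h₂ _ _ fun Δ' hΔ' => ?_
      exact (h (Δ' ∪ Δ) ⟨hX Set.subset_union_right hΔ, hY Set.subset_union_left hΔ'⟩).mono
        (by grind)
    exact this.mono (by grind)
  exact key.mono (by grind)

/-- The contexts in which `X` holds under the modality `□`, before closure. -/
def boxContexts (X : Set (Set Form)) : Set (Set Form) := {Γ | unbox Γ ∈ X}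

/-- The contexts in which `X` holds under the modality `◇`, before closure. -/
def diaContexts (X : Set (Set Form)) : Set (Set Form) :=
  {Γ | ∃ γ : Form, γ.dia ∈ Γ ∧ insert γ (unbox Γ) ∈ X}

theorem isUpperSet_boxContexts {X : Set (Set Form)} (hX : IsUpperSet X) :
    IsUpperSet (boxContexts X) :=
  fun _ _ hs hΓ => hX (unbox_mono hs) hΓ

theorem isUpperSet_diaContexts {X : Set (Set Form)} (hX : IsUpperSet X) :
    IsUpperSet (diaContexts X) :=
  fun _ _ hs ⟨γ, hγ, hΓ⟩ => ⟨γ, hs hγ, hX (Set.insert_subset_insert (unbox_mono hs)) hΓ⟩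

/-- The interpretation of a formula as a closed set of contexts. -/
def truthSet : Form → Set (Set Form)
  | .var n => {Γ | CutFree Γ (.var n)}
  | .bot => {Γ | CutFree Γ .bot}
  | .and φ ψ => truthSet φ ∩ truthSet ψ
  | .or φ ψ => contextClosure (truthSet φ ∪ truthSet ψ)
  | .imp φ ψ => {Γ | ∀ Δ, Γ ⊆ Δ → Δ ∈ truthSet φ → Δ ∈ truthSet ψ}
  | .box φ => contextClosure (boxContexts (truthSet φ))
  | .dia φ => contextClosure (diaContexts (truthSet φ))

theorem contextClosure_derivable (φ : Form) :
    contextClosure {Γ | CutFree Γ φ} ⊆ {Γ | CutFree Γ φ} := fun Γ hΓ => by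
  have := hΓ ∅ φ fun Δ hΔ => by simpa using hΔ
  simpa using this

theorem contextClosure_subset_derivable {X : Set (Set Form)} {φ : Form}
    (h : ∀ Γ ∈ X, CutFree Γ φ) {Γ : Set Form} (hΓ : Γ ∈ contextClosure X) : CutFree Γ φ :=
  contextClosure_derivable φ (contextClosure_mono h hΓ)

theorem contextClosure_truthSet (φ : Form) : contextClosure (truthSet φ) ⊆ truthSet φ := by
  induction φ with
  | var n => exact contextClosure_derivable _
  | bot => exact contextClosure_derivable _
  | and φ ψ ih₁ ih₂ =>
    exact fun Γ hΓ => ⟨ih₁ (contextClosure_mono Set.inter_subset_left hΓ),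
      ih₂ (contextClosure_mono Set.inter_subset_right hΓ)⟩
  | or φ ψ _ _ => exact contextClosure_idem _
  | imp φ ψ ih₁ ih₂ =>
    intro Γ hΓ Δ hs hΔ
    refine ih₂ fun S δ h => ?_
    have : CutFree (Γ ∪ (Δ ∪ S)) δ := by
      refine hΓ _ _ fun Θ hΘ => ?_
      have hφ : Θ ∪ Δ ∈ truthSet φ :=
        ih₁ (isUpperSet_contextClosure _ Set.subset_union_right (subset_contextClosure _ hΔ))
      exact (h _ (hΘ _ Set.subset_union_left hφ)).mono (by grind)
    exact this.mono (by grind)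
  | box φ _ => exact contextClosure_idem _
  | dia φ _ => exact contextClosure_idem _

theorem isUpperSet_truthSet (φ : Form) : IsUpperSet (truthSet φ) :=
  fun _ _ hs hΓ => contextClosure_truthSet φ
    (isUpperSet_contextClosure _ hs (subset_contextClosure _ hΓ))

theorem mem_truthSet_and_cutFree (φ : Form) :
    (∀ Γ : Set Form, φ ∈ Γ → Γ ∈ truthSet φ) ∧ ∀ Γ ∈ truthSet φ, CutFree Γ φ := by
  induction φ with
  | var n => exact ⟨fun Γ h => .id h, fun Γ h => h⟩
  | bot => exact ⟨fun Γ h => .id h, fun Γ h => h⟩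
  | and φ ψ ih₁ ih₂ =>
    refine ⟨fun Γ h => ⟨contextClosure_truthSet _ fun S δ hX => ?_,
      contextClosure_truthSet _ fun S δ hX => ?_⟩,
      fun Γ h => .andR (ih₁.2 _ h.1) (ih₂.2 _ h.2)⟩
    · exact .andL (Or.inl h) ((hX _ (ih₁.1 (insert φ Γ) (by simp))).mono (by grind))
    · exact .andL (Or.inl h) ((hX _ (ih₂.1 (insert ψ Γ) (by simp))).mono (by grind))
  | or φ ψ ih₁ ih₂ =>
    refine ⟨fun Γ h S δ hX => .orL (Or.inl h) ?_ ?_, fun Γ =>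
      contextClosure_subset_derivable fun Δ hΔ =>
        hΔ.elim (fun h => .orR₁ (ih₁.2 _ h)) fun h => .orR₂ (ih₂.2 _ h)⟩
    · exact (hX (insert φ Γ) (Or.inl (ih₁.1 _ (by simp)))).mono (by grind)
    · exact (hX (insert ψ Γ) (Or.inr (ih₂.1 _ (by simp)))).mono (by grind)
  | imp φ ψ ih₁ ih₂ =>
    refine ⟨fun Γ h Δ hs hΔ => contextClosure_truthSet _ fun S δ hX => ?_, fun Γ h => ?_⟩
    · exact .impL (Or.inl (hs h)) ((ih₁.2 _ hΔ).mono Set.subset_union_left)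
        ((hX (insert ψ Δ) (ih₂.1 _ (by simp))).mono (by grind))
    · exact .impR (ih₂.2 _ (h _ (Set.subset_insert _ _) (ih₁.1 _ (by simp))))
  | box φ ih =>
    exact ⟨fun Γ h => subset_contextClosure _ (ih.1 _ h), fun Γ =>
      contextClosure_subset_derivable fun Δ hΔ => .boxR (ih.2 _ hΔ)⟩
  | dia φ ih =>
    exact ⟨fun Γ h => subset_contextClosure _ ⟨φ, h, ih.1 _ (by simp)⟩, fun Γ =>
      contextClosure_subset_derivable (X := diaContexts (truthSet φ))
        fun Δ ⟨γ, hγ, hΔ⟩ => .dia hγ (ih.2 _ hΔ)⟩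

theorem CKAx.mem_truthSet {φ : Form} (h : CKAx φ) (Γ : Set Form) : Γ ∈ truthSet φ := by
  cases h with
  | a1 φ ψ => exact fun Δ _ hΔ Θ hs _ => isUpperSet_truthSet φ hs hΔ
  | a2 φ ψ χ =>
    exact fun Δ _ hΔ Θ hs hΘ Ξ hs' hΞ =>
      hΔ Ξ (hs.trans hs') hΞ Ξ subset_rfl (hΘ Ξ hs' hΞ)
  | a3 φ ψ => exact fun Δ _ hΔ => subset_contextClosure _ (Or.inl hΔ)
  | a4 φ ψ => exact fun Δ _ hΔ => subset_contextClosure _ (Or.inr hΔ)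
  | a5 φ ψ χ =>
    intro Δ _ hΔ Θ hs hΘ Ξ hs' hΞ
    have hu : Ξ ∈ contextClosure (truthSet (φ.imp χ) ∩ truthSet (ψ.imp χ)) :=
      subset_contextClosure _ ⟨isUpperSet_truthSet _ (hs.trans hs') hΔ,
        isUpperSet_truthSet _ hs' hΘ⟩
    refine contextClosure_truthSet χ (contextClosure_mono ?_ (contextClosure_inter
      ((isUpperSet_truthSet _).inter (isUpperSet_truthSet _))
      ((isUpperSet_truthSet _).union (isUpperSet_truthSet _)) hu hΞ))
    exact fun Λ ⟨h, h'⟩ => h'.elim (h.1 Λ subset_rfl) (h.2 Λ subset_rfl)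
  | a6 φ ψ => exact fun Δ _ hΔ => hΔ.1
  | a7 φ ψ => exact fun Δ _ hΔ => hΔ.2
  | a8 φ ψ χ => exact fun Δ _ hΔ Θ hs hΘ Ξ hs' hΞ => ⟨hΔ _ (hs.trans hs') hΞ, hΘ _ hs' hΞ⟩
  | a9 φ =>
    exact fun Δ _ hΔ => contextClosure_truthSet φ fun S δ _ =>
      .exfalso (CutFree.mono hΔ Set.subset_union_left)
  | kbox φ ψ =>
    intro Δ _ hΔ Θ hs hΘ
    refine contextClosure_mono ?_ (contextClosure_inter
      (isUpperSet_boxContexts (isUpperSet_truthSet _))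
      (isUpperSet_boxContexts (isUpperSet_truthSet _)) (isUpperSet_contextClosure _ hs hΔ) hΘ)
    exact fun Λ ⟨h, h'⟩ => h _ subset_rfl h'
  | kdia φ ψ =>
    intro Δ _ hΔ Θ hs hΘ
    refine contextClosure_mono ?_ (contextClosure_inter
      (isUpperSet_boxContexts (isUpperSet_truthSet _))
      (isUpperSet_diaContexts (isUpperSet_truthSet _)) (isUpperSet_contextClosure _ hs hΔ) hΘ)
    exact fun Λ ⟨h, γ, hγ, h'⟩ => ⟨γ, hγ, h _ (Set.subset_insert _ _) h'⟩

theorem WKAx.mem_truthSet {φ : Form} (h : WKAx φ) (Γ : Set Form) : Γ ∈ truthSet φ := by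
  cases h with
  | ck h => exact h.mem_truthSet Γ
  | n =>
    exact fun Δ _ => contextClosure_subset_derivable (X := diaContexts (truthSet .bot))
      fun Λ ⟨γ, hγ, h⟩ => .diaBot hγ h

theorem WKH.mem_truthSet {Γ : Set Form} {φ : Form} (h : WKH Γ φ)
    (hΓ : ∀ γ ∈ Γ, ∀ Δ, Δ ∈ truthSet γ) (Δ : Set Form) : Δ ∈ truthSet φ := by
  induction h generalizing Δ with
  | ax h => exact h.mem_truthSet Δ
  | el h => exact hΓ _ h Δ
  | mp _ _ ih₁ ih₂ => exact ih₂ hΓ Δ Δ subset_rfl (ih₁ hΓ Δ)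
  | nec _ ih => exact subset_contextClosure _ (ih (by simp) _)

theorem WKH.cutFree {φ ψ : Form} (h : WKH ∅ (φ.imp ψ)) : CutFree {φ} ψ :=
  (mem_truthSet_and_cutFree ψ).2 _ (h.mem_truthSet (by simp) {φ} {φ} subset_rfl
    ((mem_truthSet_and_cutFree φ).1 _ rfl))

/-- The logic WK has the Craig interpolation property. -/
theorem WK_craig_interpolation :
    ∀ φ ψ : Form, WKH ∅ (φ.imp ψ) →
      ∃ θ : Form, vars θ ⊆ vars φ ∩ vars ψ ∧
        WKH ∅ (φ.imp θ) ∧ WKH ∅ (θ.imp ψ) := by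
  intro φ ψ h
  obtain ⟨θ, hθ, hl, hr⟩ := h.cutFree.exists_interpolant (Γ₁ := {φ}) (Γ₂ := ∅)
    (L₁ := vars φ) (L₂ := vars ψ) (by simp) (by simp [formsOver]) (Set.empty_subset _)
    (by simp [formsOver])
  exact ⟨θ, hθ, .deduction (hl.mono (by simp)), hr.deduction⟩
end
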